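/- Suppose ℙ and ℚ are stationary measures on Ω with supp ℚ ⊆ supp ℙ, ℙ satisfies FE and SE with constants γ_+ < 0 and γ_- < 0, and ℚ satisfies conditions ID (with sequence (k_n)) and FE (with the same constant γ_+). Fix ε ∈ (0,1/2) and 0 < α < γ_+/(8γ_-), and consider the block auxiliary parsing of y_1^N with M_N blocks. Then, with ℓ_- := ln N/(−2γ_-), for all N large enough, ℚ{y : #S_b(y_1^N) ≥ ε M_N} ≤ exp(−N^{1−α}(2αε ln N − 2ε k_{ℓ_-} − 2 ln 2)). -/

import Mathlib

open MeasureTheory Filter Asymptotics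
open scoped ENNReal Classical

noncomputable section

namespace ZM

/-- The left shift on one-sided sequences. -/
def shift {A : Type*} (x : ℕ → A) : ℕ → A := fun k => x (k + 1)

/-- The cylinder set of all sequences starting with the word `a`. -/
def cyl {A : Type*} {n : ℕ} (a : Fin n → A) : Set (ℕ → A) := {x | ∀ i : Fin n, x i = a i}

/-- The word `x_{p+1}^{p+ℓ}` of `x` (0-based: the letters at positions `p, …, p+ℓ-1`). -/
def seg {A : Type*} (y : ℕ → A) (p ℓ : ℕ) : Fin ℓ → A := fun i => y (p + i)

/-- `w` occurs in `x` at (0-based) offset `r`. -/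
def matchAt {A : Type*} (x : ℕ → A) {ℓ : ℕ} (w : Fin ℓ → A) (r : ℕ) : Prop :=
  ∀ i : Fin ℓ, x (r + i) = w i

/-- `w` appears as a substring of `x_1^N`. -/
def appears {A : Type*} (N : ℕ) (x : ℕ → A) {ℓ : ℕ} (w : Fin ℓ → A) : Prop :=
  ∃ r, r + ℓ ≤ N ∧ matchAt x w r

/-- The waiting time `W_ℓ(w, x)`: the least (1-based) position at which `w` occurs in `x`,
`⊤` if `w` never occurs. -/
def W {A : Type*} {ℓ : ℕ} (w : Fin ℓ → A) (x : ℕ → A) : ℕ∞ :=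
  sInf {r : ℕ∞ | ∃ n : ℕ, r = (n : ℕ∞) ∧ 1 ≤ n ∧ matchAt x w (n - 1)}

section ZMparsing

variable {A : Type*}

/-- Length of the Ziv–Merhav word starting at (0-based) position `p` of `y_1^N`, with
database `x_1^N`: the longest prefix of the remaining portion of `y_1^N` appearing as a
substring of `x_1^N`, or a single letter if there is no such prefix. -/
def zmLen (N : ℕ) (x y : ℕ → A) (p : ℕ) : ℕ :=
  max 1 (sSup {ℓ | p + ℓ ≤ N ∧ appears N x (seg y p ℓ)})

/-- Starting position of the `j`-th (0-based) word of the Ziv–Merhav parsing. -/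
def zmPos (N : ℕ) (x y : ℕ → A) : ℕ → ℕ
  | 0 => 0
  | j + 1 => zmPos N x y j + zmLen N x y (zmPos N x y j)

/-- `c_N(y|x)`: the number of words in the Ziv–Merhav parsing of `y_1^N` w.r.t. `x_1^N`. -/
def cN (N : ℕ) (x y : ℕ → A) : ℕ := sInf {c | N ≤ zmPos N x y c}

/-- The Ziv–Merhav estimator `Q̂_N(y, x) = c_N(y|x) ln N / N`. -/
def ZMest (N : ℕ) (x y : ℕ → A) : ℝ := (cN N x y : ℝ) * Real.log N / N

end ZMparsing

section MeasureDefs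

variable {A : Type*} [MeasurableSpace A]

/-- The measure of the cylinder of a word, as a real number. -/
def wp (μ : Measure (ℕ → A)) {n : ℕ} (a : Fin n → A) : ℝ := (μ (cyl a)).toReal

/-- `supp ℙ`: the set of sequences all of whose prefixes have positive measure. -/
def suppSet (μ : Measure (ℕ → A)) : Set (ℕ → A) := {x | ∀ n, 0 < μ (cyl (seg x 0 n))}

/-- Condition (ID): immediate decoupling on the support, with sequence `k`. -/
def CondID (μ : Measure (ℕ → A)) (k : ℕ → ℝ) : Prop :=
  Monotone k ∧ (k =o[atTop] fun n => (n : ℝ)) ∧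
    ∀ (n m : ℕ) (a : Fin n → A) (b : Fin m → A), 0 < μ (cyl a) → 0 < μ (cyl b) →
      wp μ (Fin.append a b) ≤ Real.exp (k n) * (wp μ a * wp μ b) ∧
      (0 < μ (cyl (Fin.append a b)) →
        Real.exp (-k n) * (wp μ a * wp μ b) ≤ wp μ (Fin.append a b))

/-- Condition (FE): fast enough decay, with rate `γp < 0`. -/
def CondFE (μ : Measure (ℕ → A)) (γp : ℝ) : Prop :=
  γp < 0 ∧ ∀ᶠ n : ℕ in atTop, ∀ a : Fin n → A, 0 < μ (cyl a) → wp μ a ≤ Real.exp (γp * n)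

/-- Condition (SE): slow enough decay, with rate `γm < 0`. -/
def CondSE (μ : Measure (ℕ → A)) (γm : ℝ) : Prop :=
  γm < 0 ∧ ∀ᶠ n : ℕ in atTop, ∀ a : Fin n → A, 0 < μ (cyl a) → Real.exp (γm * n) ≤ wp μ a

/-- Condition (KB): Kontoyiannis' bound on waiting times, with sequences `k`, `τ`. -/
def CondKB (μ : Measure (ℕ → A)) (k τ : ℕ → ℝ) : Prop :=
  (k =o[atTop] fun n => (n : ℝ)) ∧ (τ =o[atTop] fun n => (n : ℝ)) ∧
    ∀ (ℓ : ℕ) (a : Fin ℓ → A) (r : ℕ),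
      (μ {x | (r : ℕ∞) ≤ W a x}).toReal ≤
        Real.exp (-(Real.exp (-k ℓ) * wp μ a * (⌊((r : ℝ) - 1) / ((ℓ : ℝ) + τ ℓ)⌋ : ℝ)))

/-- Length of the next word of the auxiliary parsing of `y_1^N` starting at position `p`:
the shortest prefix of the remaining portion of `y_1^N` with measure at most `θ`, or the
whole remaining portion if there is no such prefix. -/
def auxLen (μ : Measure (ℕ → A)) (θ : ℝ) (N : ℕ) (y : ℕ → A) (p : ℕ) : ℕ :=
  if ∃ ℓ, 1 ≤ ℓ ∧ p + ℓ ≤ N ∧ wp μ (seg y p ℓ) ≤ θ then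
    sInf {ℓ | 1 ≤ ℓ ∧ p + ℓ ≤ N ∧ wp μ (seg y p ℓ) ≤ θ}
  else N - p

/-- Starting position of the `j`-th (0-based) word of the auxiliary parsing. -/
def auxPos (μ : Measure (ℕ → A)) (θ : ℝ) (N : ℕ) (y : ℕ → A) : ℕ → ℕ
  | 0 => 0
  | j + 1 => auxPos μ θ N y j + max 1 (auxLen μ θ N y (auxPos μ θ N y j))

/-- Length of the `j`-th (0-based) word of the auxiliary parsing. -/
def auxWordLen (μ : Measure (ℕ → A)) (θ : ℝ) (N : ℕ) (y : ℕ → A) (j : ℕ) : ℕ :=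
  max 1 (auxLen μ θ N y (auxPos μ θ N y j))

/-- The number of words in the auxiliary parsing of `y_1^N`. -/
def auxCount (μ : Measure (ℕ → A)) (θ : ℝ) (N : ℕ) (y : ℕ → A) : ℕ :=
  sInf {c | N ≤ auxPos μ θ N y c}

/-- Length of the next word of the block parsing within a block ending at position `e`:
the shortest prefix of the remaining portion of the block with measure at most `θ`;
`0` encodes that no such prefix exists (the rest of the block is the buffer). -/
def blkLen (μ : Measure (ℕ → A)) (θ : ℝ) (e : ℕ) (y : ℕ → A) (p : ℕ) : ℕ :=
  sInf {ℓ | 1 ≤ ℓ ∧ p + ℓ ≤ e ∧ wp μ (seg y p ℓ) ≤ θ}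

/-- Starting position of the `i`-th (0-based) word of the block starting at `q`, ending at `e`. -/
def blkPos (μ : Measure (ℕ → A)) (θ : ℝ) (e : ℕ) (y : ℕ → A) (q : ℕ) : ℕ → ℕ
  | 0 => q
  | i + 1 => blkPos μ θ e y q i + blkLen μ θ e y (blkPos μ θ e y q i)

/-- Number `d_s` of words in the block starting at `q` and ending at `e`. -/
def dCount (μ : Measure (ℕ → A)) (θ : ℝ) (e : ℕ) (y : ℕ → A) (q : ℕ) : ℕ :=
  sInf {i | blkLen μ θ e y (blkPos μ θ e y q i) = 0}

/-- The block starting at `q` and ending at `e` is good: its parsed words are pairwise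
distinct. -/
def GoodBlock (μ : Measure (ℕ → A)) (θ : ℝ) (e : ℕ) (y : ℕ → A) (q : ℕ) : Prop :=
  ∀ i j : ℕ, i < dCount μ θ e y q → j < dCount μ θ e y q →
    blkLen μ θ e y (blkPos μ θ e y q i) = blkLen μ θ e y (blkPos μ θ e y q j) →
    (∀ t < blkLen μ θ e y (blkPos μ θ e y q i),
      y (blkPos μ θ e y q i + t) = y (blkPos μ θ e y q j + t)) →
    i = j

end MeasureDefs

/-- The block length `⌊N^α⌋`. -/
def blockB (N : ℕ) (α : ℝ) : ℕ := ⌊(N : ℝ) ^ α⌋₊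

/-- The number `M_N` of blocks. -/
def blockM (N : ℕ) (α : ℝ) : ℕ := (N + blockB N α - 1) / blockB N α

/-- The starting position of the `s`-th (0-based) block. -/
def blockStart (N : ℕ) (α : ℝ) (s : ℕ) : ℕ := s * blockB N α

/-- The end position of the `s`-th (0-based) block. -/
def blockEnd (N : ℕ) (α : ℝ) (s : ℕ) : ℕ := min ((s + 1) * blockB N α) N

/-- `S_b(y_1^N)`: the set of bad blocks of the block auxiliary parsing (with threshold
`N^{-1-ε}`, word probabilities computed with `μ`). -/
def badSet {A : Type*} [MeasurableSpace A] (μ : Measure (ℕ → A)) (N : ℕ) (α ε : ℝ)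
    (y : ℕ → A) : Set ℕ :=
  {s | s < blockM N α ∧
    ¬ GoodBlock μ ((N : ℝ) ^ (-1 - ε)) (blockEnd N α s) y (blockStart N α s)}

/-- `ℓ₋ = ln N / (-2 γ₋)`. -/
def ellMinus (N : ℕ) (γm : ℝ) : ℝ := Real.log N / (-2 * γm)

/-- `ℓ₊ = 2 ln N / (-γ₊)`. -/
def ellPlus (N : ℕ) (γp : ℝ) : ℝ := 2 * Real.log N / (-γp)

/-- `d₊ = 2 N^α / ℓ₋`. -/
def dPlus (N : ℕ) (α γm : ℝ) : ℝ := 2 * (N : ℝ) ^ α / ellMinus N γm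

section CrossEntropy

variable {A : Type*} [MeasurableSpace A] [Fintype A]

/-- The `n`-th cross-entropy average `-(1/n) ∑_{a ∈ 𝒜ⁿ} ℚ[a] ln ℙ[a]`, real-valued version. -/
def hcSeq (μP μQ : Measure (ℕ → A)) (n : ℕ) : ℝ :=
  -(1 / (n : ℝ)) * ∑ a : Fin n → A, wp μQ a * Real.log (wp μP a)

/-- `-ln p` as an element of `[0, ∞]`, for `p ∈ [0, 1]`; equals `⊤` when `p = 0`. -/
def negLog (p : ℝ≥0∞) : ℝ≥0∞ := if p = 0 then ⊤ else ENNReal.ofReal (-Real.log p.toReal)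

/-- The `n`-th cross-entropy average, `[0, ∞]`-valued version. -/
def hcSeqE (μP μQ : Measure (ℕ → A)) (n : ℕ) : ℝ≥0∞ :=
  (∑ a : Fin n → A, μQ (cyl a) * negLog (μP (cyl a))) / (n : ℝ≥0∞)

end CrossEntropy

end ZM

namespace ZM

section FiniteHorizon

variable {A : Type*}

/-- Membership in `F` is determined by the first `m` letters, for some `m`. -/
def FiniteHorizon (F : Set (ℕ → A)) : Prop :=
  ∃ m, ∀ x y : ℕ → A, (∀ i < m, x i = y i) → x ∈ F → y ∈ F

theorem shift_iterate_apply (n : ℕ) (x : ℕ → A) (i : ℕ) : (shift^[n] x) i = x (n + i) := by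
  induction n generalizing x with
  | zero => simp
  | succ n ih =>
    rw [Function.iterate_succ_apply, ih]
    simp only [shift]
    congr 1
    omega

theorem FiniteHorizon.inter {F G : Set (ℕ → A)} (hF : FiniteHorizon F) (hG : FiniteHorizon G) :
    FiniteHorizon (F ∩ G) := by
  obtain ⟨m, hm⟩ := hF
  obtain ⟨n, hn⟩ := hG
  refine ⟨max m n, fun x y h hx => ⟨hm x y (fun i hi => h i ?_) hx.1,
    hn x y (fun i hi => h i ?_) hx.2⟩⟩ <;> omega

theorem FiniteHorizon.preimage_shift {F : Set (ℕ → A)} (hF : FiniteHorizon F) (n : ℕ) :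
    FiniteHorizon (shift^[n] ⁻¹' F) := by
  obtain ⟨m, hm⟩ := hF
  refine ⟨n + m, fun x y h hx => hm _ _ (fun i hi => ?_) hx⟩
  rw [shift_iterate_apply, shift_iterate_apply]
  exact h _ (by omega)

theorem finiteHorizon_cyl {n : ℕ} (a : Fin n → A) : FiniteHorizon (cyl a) :=
  ⟨n, fun x y h hx i => by rw [← h i i.2]; exact hx i⟩

theorem cyl_append {n m : ℕ} (a : Fin n → A) (b : Fin m → A) :
    cyl (Fin.append a b) = cyl a ∩ shift^[n] ⁻¹' cyl b := by
  ext x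
  simp only [cyl, Set.mem_ofPred_eq, Set.mem_inter_iff, Set.mem_preimage, shift_iterate_apply]
  refine ⟨fun h => ⟨fun i => ?_, fun i => ?_⟩, fun h i => ?_⟩
  · simpa using h (Fin.castAdd m i)
  · simpa using h (Fin.natAdd n i)
  · refine Fin.addCases (fun i => ?_) (fun i => ?_) i
    · simpa using h.1 i
    · simpa using h.2 i

theorem mem_cyl_iff {n : ℕ} (a : Fin n → A) (x : ℕ → A) : x ∈ cyl a ↔ seg x 0 n = a := by
  simp only [cyl, Set.mem_ofPred_eq, funext_iff, seg, Nat.zero_add]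

theorem pairwise_disjoint_cyl (n : ℕ) :
    Pairwise (Function.onFun Disjoint fun a : Fin n → A => cyl a) := by
  intro a b hab
  rw [Function.onFun, Set.disjoint_left]
  intro x ha hb
  rw [mem_cyl_iff] at ha hb
  exact hab (ha.symm.trans hb)

end FiniteHorizon

section Decoupling

variable {A : Type*} [Fintype A]

theorem FiniteHorizon.exists_eq_biUnion_cyl {F : Set (ℕ → A)} (hF : FiniteHorizon F) :
    ∃ (m : ℕ) (G : Finset (Fin m → A)), F = ⋃ b ∈ G, cyl b := by
  obtain ⟨m, hm⟩ := hF
  refine ⟨m, Finset.univ.filter fun b => ∃ x ∈ F, seg x 0 m = b, ?_⟩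
  ext x
  simp only [Finset.mem_filter, Finset.mem_univ, true_and, Set.mem_iUnion, mem_cyl_iff,
    exists_prop]
  constructor
  · exact fun hx => ⟨_, ⟨x, hx, rfl⟩, rfl⟩
  · rintro ⟨b, ⟨z, hz, hzb⟩, hxb⟩
    refine hm z x (fun i hi => ?_) hz
    simpa [seg] using congrFun (hzb.trans hxb.symm) ⟨i, hi⟩

variable [MeasurableSpace A] [MeasurableSingletonClass A]

theorem measurableSet_cyl {n : ℕ} (a : Fin n → A) : MeasurableSet (cyl a) := by
  simp only [cyl, Set.ofPred_forall]
  exact MeasurableSet.iInter fun i =>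
    measurableSet_eq_fun (measurable_pi_apply (i : ℕ)) measurable_const

theorem FiniteHorizon.measurableSet {F : Set (ℕ → A)} (hF : FiniteHorizon F) :
    MeasurableSet F := by
  obtain ⟨m, G, rfl⟩ := hF.exists_eq_biUnion_cyl
  exact G.measurableSet_biUnion fun b _ => measurableSet_cyl b

variable {μ : Measure (ℕ → A)}

theorem measureReal_preimage_shift (hμ : MeasurePreserving shift μ μ) {F : Set (ℕ → A)}
    (hF : FiniteHorizon F) (n : ℕ) : μ.real (shift^[n] ⁻¹' F) = μ.real F :=
  (hμ.iterate n).measureReal_preimage hF.measurableSet.nullMeasurableSet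

variable [IsProbabilityMeasure μ]

theorem sum_wp (n : ℕ) : ∑ a : Fin n → A, wp μ a = 1 := by
  have h := measureReal_biUnion_finset (μ := μ) (s := Finset.univ) (f := fun a : Fin n → A => cyl a)
    (fun a _ b _ hab => pairwise_disjoint_cyl n hab) (fun a _ => measurableSet_cyl a)
  have hU : (⋃ a ∈ (Finset.univ : Finset (Fin n → A)), cyl a) = Set.univ := by
    ext x
    simp [mem_cyl_iff]
  rw [hU, probReal_univ] at h
  exact h.symm

theorem CondID.measureReal_cyl_inter_le {k : ℕ → ℝ} (hID : CondID μ k)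
    (hμ : MeasurePreserving shift μ μ) {n : ℕ} (a : Fin n → A) {F : Set (ℕ → A)}
    (hF : FiniteHorizon F) :
    μ.real (cyl a ∩ shift^[n] ⁻¹' F) ≤ Real.exp (k n) * (wp μ a * μ.real F) := by
  obtain ⟨m, G, rfl⟩ := hF.exists_eq_biUnion_cyl
  have hpair (b : Fin m → A) :
      μ.real (cyl (Fin.append a b)) ≤ Real.exp (k n) * (wp μ a * wp μ b) := by
    have h0 : 0 ≤ Real.exp (k n) * (wp μ a * wp μ b) := by unfold wp; positivity
    by_cases ha : μ (cyl a) = 0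
    · refine le_trans (le_of_eq ?_) h0
      rw [cyl_append, measureReal_def, measure_mono_null Set.inter_subset_left ha]
      simp
    by_cases hb : μ (cyl b) = 0
    · refine le_trans ?_ h0
      calc μ.real (cyl (Fin.append a b)) ≤ μ.real (shift^[n] ⁻¹' cyl b) := by
            rw [cyl_append]
            exact measureReal_mono Set.inter_subset_right
        _ = μ.real (cyl b) := measureReal_preimage_shift hμ (finiteHorizon_cyl b) n
        _ = 0 := by simp [measureReal_def, hb]
        _ ≤ 0 := le_rfl
    · exact (hID.2.2 n m a b (pos_iff_ne_zero.2 ha) (pos_iff_ne_zero.2 hb)).1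
  have hset : cyl a ∩ shift^[n] ⁻¹' (⋃ b ∈ G, cyl b) = ⋃ b ∈ G, cyl (Fin.append a b) := by
    simp only [cyl_append, Set.preimage_iUnion, Set.inter_iUnion]
  rw [hset, measureReal_biUnion_finset (fun b _ c _ hbc => pairwise_disjoint_cyl m hbc)
    (fun b _ => measurableSet_cyl b), Finset.mul_sum, Finset.mul_sum]
  exact (measureReal_biUnion_finset_le _ _).trans (Finset.sum_le_sum fun b _ => hpair b)

end Decoupling

section Repetition

/-- Some word of length `L` occurs twice, without overlap, among the first `B` letters. -/
def repeats {A : Type*} (L B : ℕ) : Set (ℕ → A) :=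
  {x | ∃ i j, i + L ≤ j ∧ j + L ≤ B ∧ ∀ t < L, x (i + t) = x (j + t)}

/-- The number of blocks `s < M` of length `B` in which a word of length `L` repeats. -/
def repeatCount {A : Type*} (L B M : ℕ) (x : ℕ → A) : ℕ :=
  ((Finset.range M).filter fun s => shift^[s * B] x ∈ repeats L B).card

theorem finiteHorizon_repeats {A : Type*} (L B : ℕ) :
    FiniteHorizon (repeats L B : Set (ℕ → A)) := by
  refine ⟨B, ?_⟩
  rintro x y h ⟨i, j, hij, hj, hx⟩
  refine ⟨i, j, hij, hj, fun t ht => ?_⟩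
  rw [← h _ (by omega), ← h _ (by omega)]
  exact hx t ht

theorem repeatCount_succ {A : Type*} (L B M : ℕ) (x : ℕ → A) :
    repeatCount L B (M + 1) x =
      repeatCount L B M (shift^[B] x) + if x ∈ repeats L B then 1 else 0 := by
  unfold repeatCount
  rw [Finset.card_filter, Finset.card_filter, Finset.sum_range_succ']
  congr 1
  · refine Finset.sum_congr rfl fun s _ => ?_
    rw [← Function.iterate_add_apply, Nat.succ_mul]
  · simp

theorem finiteHorizon_le_repeatCount {A : Type*} (L B M c : ℕ) :
    FiniteHorizon {x : ℕ → A | c ≤ repeatCount L B M x} := by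
  refine ⟨M * B, fun x y h hx => le_trans (Set.mem_ofPred.1 hx) (Finset.card_le_card ?_)⟩
  intro s hs
  rw [Finset.mem_filter, Finset.mem_range] at hs ⊢
  obtain ⟨hs, i, j, hij, hj, ht⟩ := hs
  refine ⟨hs, i, j, hij, hj, fun t htL => ?_⟩
  have hsB : s * B + B ≤ M * B := by
    calc s * B + B = (s + 1) * B := by ring
      _ ≤ M * B := Nat.mul_le_mul_right _ hs
  have := ht t htL
  rw [shift_iterate_apply, shift_iterate_apply] at this ⊢
  rwa [← h _ (by omega), ← h _ (by omega)]

variable {A : Type*} [Fintype A] [MeasurableSpace A] [MeasurableSingletonClass A]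
  {μ : Measure (ℕ → A)} [IsProbabilityMeasure μ]

theorem CondID.measureReal_repeat_at_le {k : ℕ → ℝ} (hID : CondID μ k)
    (hμ : MeasurePreserving shift μ μ) {L i j B : ℕ} {q : ℝ} (hq : ∀ a : Fin L → A, wp μ a ≤ q)
    (hij : i + L ≤ j) (hj : j + L ≤ B) {F : Set (ℕ → A)} (hF : FiniteHorizon F) :
    μ.real ({x | ∀ t < L, x (i + t) = x (j + t)} ∩ shift^[B] ⁻¹' F) ≤
      Real.exp (2 * k L) * q * μ.real F := by
  obtain ⟨d, rfl⟩ := Nat.exists_eq_add_of_le hij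
  obtain ⟨r, rfl⟩ := Nat.exists_eq_add_of_le hj
  have hFr := hF.preimage_shift r
  have hin (w : Fin L → A) := (finiteHorizon_cyl w).inter (hFr.preimage_shift L)
  have hout (w : Fin L → A) :=
    (finiteHorizon_cyl w).inter (((hin w).preimage_shift d).preimage_shift L)
  have hsub : ({x | ∀ t < L, x (i + t) = x (i + L + d + t)} ∩ shift^[i + L + d + L + r] ⁻¹' F :
      Set (ℕ → A)) ⊆ ⋃ w ∈ (Finset.univ : Finset (Fin L → A)), shift^[i] ⁻¹' (cyl w ∩
        shift^[L] ⁻¹' (shift^[d] ⁻¹' (cyl w ∩ shift^[L] ⁻¹' (shift^[r] ⁻¹' F)))) := by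
    rintro x ⟨hx, hxF⟩
    simp only [Set.mem_iUnion, Finset.mem_univ, exists_prop, true_and]
    refine ⟨seg x i L, fun t => ?_, fun t => ?_, ?_⟩
    · rw [shift_iterate_apply]; rfl
    · simp only [shift_iterate_apply, seg]
      rw [hx t t.2]
      congr 1
      omega
    · simp only [Set.mem_preimage, ← Function.iterate_add_apply] at hxF ⊢
      rwa [show r + (L + (d + (L + i))) = i + L + d + L + r by ring]
  have hw (w : Fin L → A) : μ.real (shift^[i] ⁻¹' (cyl w ∩
        shift^[L] ⁻¹' (shift^[d] ⁻¹' (cyl w ∩ shift^[L] ⁻¹' (shift^[r] ⁻¹' F))))) ≤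
      wp μ w * (Real.exp (2 * k L) * q * μ.real F) := by
    have h1 := hID.measureReal_cyl_inter_le hμ w ((hin w).preimage_shift d)
    have h2 := hID.measureReal_cyl_inter_le hμ w hFr
    rw [measureReal_preimage_shift hμ (hin w)] at h1
    rw [measureReal_preimage_shift hμ hF] at h2
    have h0 : 0 ≤ wp μ w := ENNReal.toReal_nonneg
    rw [measureReal_preimage_shift hμ (hout w)]
    calc _ ≤ _ := h1
      _ ≤ Real.exp (k L) * (wp μ w * (Real.exp (k L) * (q * μ.real F))) := by
          gcongr
          refine h2.trans ?_
          gcongr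
          exact hq w
      _ = _ := by rw [two_mul, Real.exp_add]; ring
  calc _ ≤ _ := measureReal_mono hsub (measure_ne_top _ _)
    _ ≤ _ := measureReal_biUnion_finset_le _ _
    _ ≤ ∑ w : Fin L → A, wp μ w * (Real.exp (2 * k L) * q * μ.real F) :=
        Finset.sum_le_sum fun w _ => hw w
    _ = _ := by rw [← Finset.sum_mul, sum_wp, one_mul]

theorem CondID.measureReal_repeats_inter_le {k : ℕ → ℝ} (hID : CondID μ k)
    (hμ : MeasurePreserving shift μ μ) {L B : ℕ} (hL : 0 < L) {q : ℝ} (hq0 : 0 ≤ q)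
    (hq : ∀ a : Fin L → A, wp μ a ≤ q) {F : Set (ℕ → A)} (hF : FiniteHorizon F) :
    μ.real (repeats L B ∩ shift^[B] ⁻¹' F) ≤ (B ^ 2 * (Real.exp (2 * k L) * q)) * μ.real F := by
  let P := (Finset.range B ×ˢ Finset.range B).filter fun p => p.1 + L ≤ p.2 ∧ p.2 + L ≤ B
  have hsub : (repeats L B ∩ shift^[B] ⁻¹' F : Set (ℕ → A)) ⊆
      ⋃ p ∈ P, ({x | ∀ t < L, x (p.1 + t) = x (p.2 + t)} ∩ shift^[B] ⁻¹' F) := by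
    rintro x ⟨⟨i, j, hij, hj, hx⟩, hxF⟩
    simp only [Set.mem_iUnion, exists_prop]
    refine ⟨(i, j), ?_, hx, hxF⟩
    simp only [P, Finset.mem_filter, Finset.mem_product, Finset.mem_range]
    omega
  have hP : (P.card : ℝ) ≤ B ^ 2 := by
    have : P.card ≤ B * B := by
      simpa using Finset.card_filter_le (Finset.range B ×ˢ Finset.range B) _
    rw [sq]
    exact_mod_cast this
  calc _ ≤ _ := measureReal_mono hsub (measure_ne_top _ _)
    _ ≤ _ := measureReal_biUnion_finset_le _ _
    _ ≤ ∑ p ∈ P, Real.exp (2 * k L) * q * μ.real F := Finset.sum_le_sum fun p hp => by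
        have := (Finset.mem_filter.1 hp).2
        exact hID.measureReal_repeat_at_le hμ hq this.1 this.2 hF
    _ = P.card * (Real.exp (2 * k L) * q * μ.real F) := by rw [Finset.sum_const, nsmul_eq_mul]
    _ ≤ B ^ 2 * (Real.exp (2 * k L) * q * μ.real F) := by gcongr
    _ = _ := by ring

theorem measureReal_le_repeatCount {L B : ℕ} (hμ : MeasurePreserving shift μ μ) {β : ℝ}
    (hβ : 0 ≤ β)
    (h : ∀ F : Set (ℕ → A), FiniteHorizon F →
      μ.real (repeats L B ∩ shift^[B] ⁻¹' F) ≤ β * μ.real F) (M c : ℕ) :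
    μ.real {x | c ≤ repeatCount L B M x} ≤ 2 ^ M * β ^ c := by
  induction M generalizing c with
  | zero =>
    rcases c with _ | c
    · simp
    · simp only [repeatCount, Finset.range_zero, Finset.filter_empty, Finset.card_empty,
        Nat.le_zero_eq, Nat.succ_ne_zero, Set.ofPred_false, measureReal_empty]
      positivity
  | succ M ih =>
    rcases c with _ | c
    · simpa using one_le_pow₀ (M₀ := ℝ) (n := M + 1) one_le_two
    have hsub : {x : ℕ → A | c + 1 ≤ repeatCount L B (M + 1) x} ⊆
        (repeats L B ∩ shift^[B] ⁻¹' {x | c ≤ repeatCount L B M x}) ∪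
          shift^[B] ⁻¹' {x | c + 1 ≤ repeatCount L B M x} := by
      intro x hx
      rw [Set.mem_ofPred_eq, repeatCount_succ] at hx
      by_cases hr : x ∈ repeats L B
      · left
        rw [if_pos hr] at hx
        exact ⟨hr, by simpa using hx⟩
      · right
        rw [if_neg hr] at hx
        exact hx
    calc _ ≤ _ := measureReal_mono hsub
      _ ≤ _ := measureReal_union_le _ _
      _ ≤ β * (2 ^ M * β ^ c) + 2 ^ M * β ^ (c + 1) := by
          rw [measureReal_preimage_shift hμ (finiteHorizon_le_repeatCount L B M (c + 1))]
          refine add_le_add ((h _ (finiteHorizon_le_repeatCount L B M c)).trans ?_) (ih _)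
          gcongr
          exact ih c
      _ = _ := by ring

end Repetition

section BadBlocks

variable {A : Type*} [MeasurableSpace A]

theorem measure_cyl_seg_pos {μ : Measure (ℕ → A)} (hμ : MeasurePreserving shift μ μ)
    {y : ℕ → A} (hy : y ∈ suppSet μ) (p n : ℕ) : 0 < μ (cyl (seg y p n)) := by
  have hp := hμ.iterate p
  refine (hy (p + n)).trans_le ?_
  calc μ (cyl (seg y 0 (p + n))) ≤ μ (shift^[p] ⁻¹' cyl (seg y p n)) := by
        refine measure_mono fun x hx i => ?_
        rw [shift_iterate_apply]
        simpa [seg] using hx ⟨p + i, by omega⟩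
    _ ≤ μ.map shift^[p] (cyl (seg y p n)) := Measure.le_map_apply hp.aemeasurable _
    _ = μ (cyl (seg y p n)) := by rw [hp.map_eq]

theorem exists_repeat_of_not_goodBlock {μ : Measure (ℕ → A)} [IsProbabilityMeasure μ]
    (hμ : MeasurePreserving shift μ μ)
    {y : ℕ → A} (hy : y ∈ suppSet μ) {θ : ℝ} {L e q : ℕ}
    (hθ : ∀ a : Fin L → A, 0 < μ (cyl a) → θ < wp μ a) (hbad : ¬ GoodBlock μ θ e y q) :
    ∃ i j, q ≤ i ∧ i + L ≤ j ∧ j + L ≤ e ∧ ∀ t < L, y (i + t) = y (j + t) := by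
  have hmono : Monotone (blkPos μ θ e y q) :=
    monotone_nat_of_le_succ fun i => Nat.le_add_right _ _
  have hword (i : ℕ) (hi : i < dCount μ θ e y q) :
      L ≤ blkLen μ θ e y (blkPos μ θ e y q i) ∧
        blkPos μ θ e y q i + blkLen μ θ e y (blkPos μ θ e y q i) ≤ e := by
    have hne : blkLen μ θ e y (blkPos μ θ e y q i) ≠ 0 := fun h =>
      Nat.notMem_of_lt_sInf hi h
    generalize blkPos μ θ e y q i = p at hne ⊢
    obtain ⟨-, he, hwp⟩ := Nat.sInf_mem (Nat.nonempty_of_pos_sInf (Nat.pos_of_ne_zero hne))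
    refine ⟨?_, he⟩
    by_contra! hlt
    refine absurd ((hθ _ (measure_cyl_seg_pos hμ hy p L)).trans_le ?_) hwp.not_gt
    refine ENNReal.toReal_mono (measure_ne_top _ _) (measure_mono fun x hx t => ?_)
    simpa [seg] using hx ⟨t, t.2.trans hlt⟩
  have hordered (i j : ℕ) (hi : i < dCount μ θ e y q) (hj : j < dCount μ θ e y q) (hij : i < j)
      (heq : ∀ t < blkLen μ θ e y (blkPos μ θ e y q i),
        y (blkPos μ θ e y q i + t) = y (blkPos μ θ e y q j + t)) :
      ∃ i j, q ≤ i ∧ i + L ≤ j ∧ j + L ≤ e ∧ ∀ t < L, y (i + t) = y (j + t) := by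
    obtain ⟨hLi, -⟩ := hword i hi
    obtain ⟨hLj, hej⟩ := hword j hj
    have h1 : blkPos μ θ e y q i + blkLen μ θ e y (blkPos μ θ e y q i) ≤ blkPos μ θ e y q j :=
      hmono (Nat.succ_le_of_lt hij)
    exact ⟨_, _, hmono (Nat.zero_le i), by omega, by omega, fun t ht => heq t (by omega)⟩
  unfold GoodBlock at hbad
  push Not at hbad
  obtain ⟨i, j, hi, hj, hlen, heq, hne⟩ := hbad
  rcases hne.lt_or_gt with h | h
  · exact hordered i j hi hj h heq
  · exact hordered j i hj hi h fun t ht => (heq t (hlen ▸ ht)).symm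

theorem ncard_badSet_le {μ : Measure (ℕ → A)} [IsProbabilityMeasure μ]
    (hμ : MeasurePreserving shift μ μ)
    {y : ℕ → A} (hy : y ∈ suppSet μ) {N L : ℕ} {α ε : ℝ}
    (hθ : ∀ a : Fin L → A, 0 < μ (cyl a) → (N : ℝ) ^ (-1 - ε) < wp μ a) :
    (badSet μ N α ε y).ncard ≤ repeatCount L (blockB N α) (blockM N α) y := by
  rw [repeatCount, ← Set.ncard_coe_finset]
  refine Set.ncard_le_ncard (fun s hs => ?_) (Finset.finite_toSet _)
  rw [Finset.mem_coe, Finset.mem_filter, Finset.mem_range]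
  obtain ⟨i, j, hqi, hij, hj, ht⟩ := exists_repeat_of_not_goodBlock hμ hy hθ hs.2
  have he : blockEnd N α s ≤ s * blockB N α + blockB N α := by
    rw [← Nat.succ_mul]
    exact min_le_left _ _
  unfold blockStart at hqi
  refine ⟨hs.1, i - s * blockB N α, j - s * blockB N α, by omega, by omega, fun t htL => ?_⟩
  rw [shift_iterate_apply, shift_iterate_apply]
  convert ht t htL using 2 <;> omega

theorem ae_mem_suppSet [Finite A] (μ : Measure (ℕ → A)) : ∀ᵐ y ∂μ, y ∈ suppSet μ := by
  have h : ∀ᵐ y ∂μ, ∀ (n : ℕ) (a : Fin n → A), μ (cyl a) = 0 → y ∉ cyl a := by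
    rw [ae_all_iff]
    intro n
    rw [ae_all_iff]
    intro a
    by_cases ha : μ (cyl a) = 0
    · filter_upwards [measure_eq_zero_iff_ae_notMem.1 ha] with y hy _ using hy
    · exact Eventually.of_forall fun y h => absurd h ha
  filter_upwards [h] with y hy n
  exact pos_iff_ne_zero.2 fun h0 => hy n _ h0 ((mem_cyl_iff _ _).2 rfl)

end BadBlocks

section Asymptotics

theorem rpow_one_sub_le_blockM {N : ℕ} {α : ℝ} (hN : 1 ≤ N) (hα : 0 ≤ α) :
    (N : ℝ) ^ (1 - α) ≤ blockM N α := by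
  have hN' : (1 : ℝ) ≤ N := by exact_mod_cast hN
  have hpow : 0 < (N : ℝ) ^ α := by positivity
  have hB : 0 < blockB N α := Nat.floor_pos.2 (Real.one_le_rpow hN' hα)
  have hBle : (blockB N α : ℝ) ≤ (N : ℝ) ^ α := Nat.floor_le hpow.le
  have hM : N ≤ blockM N α * blockB N α := by
    have h := Nat.div_add_mod (N + blockB N α - 1) (blockB N α)
    have h' := Nat.mod_lt (N + blockB N α - 1) hB
    rw [blockM, mul_comm]
    omega
  rw [Real.rpow_sub (by positivity), Real.rpow_one, div_le_iff₀ hpow]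
  calc (N : ℝ) ≤ blockM N α * blockB N α := by exact_mod_cast hM
    _ ≤ blockM N α * (N : ℝ) ^ α := by gcongr

theorem tendsto_log_natCast : Tendsto (fun N : ℕ => Real.log N) atTop atTop :=
  Real.tendsto_log_atTop.comp tendsto_natCast_atTop_atTop

theorem tendsto_ceil_ellMinus {γ : ℝ} (hγ : γ < 0) :
    Tendsto (fun N : ℕ => ⌈ellMinus N γ⌉₊) atTop atTop :=
  tendsto_nat_ceil_atTop.comp (tendsto_log_natCast.atTop_div_const (by linarith))

theorem eventually_threshold_lt {γ ε : ℝ} (hγ : γ < 0) (hε : 0 < ε) :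
    ∀ᶠ N : ℕ in atTop, (N : ℝ) ^ (-1 - ε) < Real.exp (γ * ⌈ellMinus N γ⌉₊) := by
  filter_upwards [eventually_ge_atTop 1, tendsto_log_natCast.eventually_gt_atTop (-γ * 2)]
    with N hN hlog
  have hN' : (1 : ℝ) ≤ N := by exact_mod_cast hN
  rw [Real.rpow_def_of_pos (by positivity), Real.exp_lt_exp]
  have h0 : 0 ≤ ellMinus N γ := div_nonneg (Real.log_nonneg hN') (by linarith)
  have h1 := (Nat.ceil_lt_add_one h0).le
  have h2 : γ * (ellMinus N γ + 1) ≤ γ * ⌈ellMinus N γ⌉₊ := mul_le_mul_of_nonpos_left h1 hγ.le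
  have h3 : γ * ellMinus N γ = -(Real.log N / 2) := by
    unfold ellMinus
    field [hγ.ne]
  nlinarith [mul_nonneg hε.le (Real.log_nonneg hN')]

theorem eventually_le_exponent {k : ℕ → ℝ} (hk : k =o[atTop] fun n => (n : ℝ)) {γ α ε : ℝ}
    (hγ : γ < 0) (hα : 0 < α) (hε : 0 < ε) (C : ℝ) :
    ∀ᶠ N : ℕ in atTop,
      C ≤ 2 * α * ε * Real.log N - 2 * ε * k ⌈ellMinus N γ⌉₊ := by
  have hδ : 0 < -γ * α := by nlinarith
  filter_upwards [eventually_ge_atTop 1, (tendsto_ceil_ellMinus hγ).eventually (hk.bound hδ),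
    (tendsto_log_natCast.const_mul_atTop (mul_pos hα hε)).eventually_ge_atTop
      (C + 2 * ε * (-γ * α))] with N hN hkN hlog
  have hN' : (1 : ℝ) ≤ N := by exact_mod_cast hN
  have h0 : 0 ≤ ellMinus N γ := div_nonneg (Real.log_nonneg hN') (by linarith)
  have h1 := (Nat.ceil_lt_add_one h0).le
  rw [Real.norm_eq_abs, Real.norm_eq_abs, Nat.abs_cast] at hkN
  have h3 : γ * ellMinus N γ = -(Real.log N / 2) := by
    unfold ellMinus
    field [hγ.ne]
  have h4 : k ⌈ellMinus N γ⌉₊ ≤ α * Real.log N / 2 + -γ * α := by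
    calc _ ≤ _ := le_abs_self _
      _ ≤ _ := hkN
      _ ≤ -γ * α * (ellMinus N γ + 1) := by gcongr
      _ = -α * (γ * ellMinus N γ) + -γ * α := by ring
      _ = _ := by rw [h3]; ring
  nlinarith [mul_le_mul_of_nonneg_left h4 (mul_pos two_pos hε).le]

theorem exp_mul_ceil_ellMinus_le {N : ℕ} {γp γm α : ℝ} (hN : 1 ≤ N) (hγp : γp < 0)
    (hγm : γm < 0) (hα : α < γp / (8 * γm)) :
    Real.exp (γp * ⌈ellMinus N γm⌉₊) ≤ Real.exp (-(4 * α * Real.log N)) := by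
  have hN' : (1 : ℝ) ≤ N := by exact_mod_cast hN
  have hlog := Real.log_nonneg hN'
  rw [Real.exp_le_exp]
  calc γp * ⌈ellMinus N γm⌉₊ ≤ γp * ellMinus N γm :=
        mul_le_mul_of_nonpos_left (Nat.le_ceil _) hγp.le
    _ = -(4 * (γp / (8 * γm)) * Real.log N) := by
        unfold ellMinus
        field [hγm.ne]
    _ ≤ _ := by
        have := mul_le_mul_of_nonneg_right hα.le hlog
        linarith

end Asymptotics

section Discrete

/-- The bound for an alphabet on which all letters are measurable. -/
theorem many_bad_blocks_prob_of_measurableSingletonClass {A : Type*} [Fintype A]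
    [MeasurableSpace A] [MeasurableSingletonClass A]
    (μP μQ : Measure (ℕ → A)) [IsProbabilityMeasure μP] [IsProbabilityMeasure μQ]
    (hPstat : MeasurePreserving shift μP μP)
    (hQstat : MeasurePreserving shift μQ μQ)
    (hsupp : suppSet μQ ⊆ suppSet μP)
    {γp γm : ℝ} (hPSE : CondSE μP γm)
    {kQ : ℕ → ℝ} (hQID : CondID μQ kQ) (hQFE : CondFE μQ γp)
    {ε α : ℝ} (hε : 0 < ε) (hα : 0 < α) (hαγ : α < γp / (8 * γm)) :
    ∀ᶠ N : ℕ in atTop,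
      (μQ {y | ε * blockM N α ≤ ((badSet μP N α ε y).ncard : ℝ)}).toReal ≤
        Real.exp (-(N : ℝ) ^ (1 - α) *
          (2 * α * ε * Real.log N - 2 * ε * kQ ⌈ellMinus N γm⌉₊ - 2 * Real.log 2)) := by
  have hL := tendsto_ceil_ellMinus hPSE.1
  filter_upwards [eventually_ge_atTop 1, hL.eventually hPSE.2, hL.eventually hQFE.2,
    hL.eventually_gt_atTop 0, eventually_threshold_lt hPSE.1 hε,
    eventually_le_exponent hQID.2.1 hPSE.1 hα hε (Real.log 2)] with N hN hSE hFE hL0 hthr hexp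
  have hmeas := exp_mul_ceil_ellMinus_le hN hQFE.1 hPSE.1 hαγ
  have hMN := rpow_one_sub_le_blockM hN hα.le
  set L := ⌈ellMinus N γm⌉₊
  set M := blockM N α
  have hN' : (1 : ℝ) ≤ N := by exact_mod_cast hN
  have hB : (blockB N α : ℝ) ≤ Real.exp (α * Real.log N) := by
    calc (blockB N α : ℝ) ≤ (N : ℝ) ^ α := Nat.floor_le (by positivity)
      _ = _ := by rw [Real.rpow_def_of_pos (by positivity), mul_comm]
  have hq (a : Fin L → A) : wp μQ a ≤ Real.exp (-(4 * α * Real.log N)) := by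
    rcases eq_zero_or_pos (μQ (cyl a)) with h | h
    · rw [wp, h]
      exact (Real.exp_pos _).le
    · exact (hFE a h).trans hmeas
  set β := Real.exp (2 * kQ L - 2 * α * Real.log N) with hβ
  have hrep (F : Set (ℕ → A)) (hF : FiniteHorizon F) :
      μQ.real (repeats L (blockB N α) ∩ shift^[blockB N α] ⁻¹' F) ≤ β * μQ.real F := by
    refine (hQID.measureReal_repeats_inter_le hQstat hL0 (Real.exp_pos _).le hq hF).trans ?_
    refine mul_le_mul_of_nonneg_right ?_ measureReal_nonneg
    calc _ ≤ Real.exp (α * Real.log N) ^ 2 *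
          (Real.exp (2 * kQ L) * Real.exp (-(4 * α * Real.log N))) := by gcongr
      _ = β := by
          rw [← Real.exp_nat_mul, ← Real.exp_add, ← Real.exp_add, hβ]
          congr 1
          push_cast
          ring
  have hle : μQ.real {y | ε * M ≤ ((badSet μP N α ε y).ncard : ℝ)} ≤
      μQ.real {y | ⌈ε * M⌉₊ ≤ repeatCount L (blockB N α) M y} := by
    refine ENNReal.toReal_mono (measure_ne_top _ _) (measure_mono_ae ?_)
    filter_upwards [ae_mem_suppSet μQ] with y hy hyb
    exact (Nat.ceil_le.2 hyb).trans
      (ncard_badSet_le hPstat (hsupp hy) fun a ha => hthr.trans_le (hSE a ha))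
  have hlog2 := Real.log_pos one_lt_two
  have hneg : 2 * kQ L - 2 * α * Real.log N ≤ 0 := by
    by_contra! h
    nlinarith [mul_pos hε h]
  calc _ ≤ _ := hle
    _ ≤ 2 ^ M * β ^ ⌈ε * M⌉₊ := measureReal_le_repeatCount hQstat (Real.exp_pos _).le hrep _ _
    _ = Real.exp (M * Real.log 2 + ⌈ε * M⌉₊ * (2 * kQ L - 2 * α * Real.log N)) := by
        rw [Real.exp_add, Real.exp_nat_mul, Real.exp_nat_mul, Real.exp_log two_pos]
    _ ≤ _ := by
        rw [Real.exp_le_exp]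
        have h1 := mul_le_mul_of_nonpos_right (Nat.le_ceil (ε * M)) hneg
        have h2 := mul_le_mul_of_nonneg_right hMN (sub_nonneg.2 hexp)
        have h3 : 0 ≤ (N : ℝ) ^ (1 - α) * Real.log 2 := by positivity
        linarith

end Discrete

section Quotient

variable {A B : Type*}

theorem comp_append {n m : ℕ} (f : A → B) (a : Fin n → A) (b : Fin m → A) :
    f ∘ Fin.append a b = Fin.append (f ∘ a) (f ∘ b) := by
  ext i
  refine Fin.addCases (fun i => ?_) (fun i => ?_) i <;> simp

variable [mA : MeasurableSpace A] [mB : MeasurableSpace B] {f : A → B}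

theorem measurable_comp_left (hf : Measurable f) : Measurable fun x : ℕ → A => f ∘ x :=
  measurable_pi_lambda _ fun i => hf.comp (measurable_pi_apply i)

theorem measurePreserving_shift_map_comp (hf : Measurable f) {μ : Measure (ℕ → A)}
    (hμ : MeasurePreserving shift μ μ) :
    MeasurePreserving shift (μ.map (f ∘ ·)) (μ.map (f ∘ ·)) := by
  have hs : Measurable (shift : (ℕ → B) → ℕ → B) :=
    measurable_pi_lambda _ fun i => measurable_pi_apply (i + 1)
  refine ⟨hs, ?_⟩
  rw [Measure.map_map hs (measurable_comp_left hf)]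
  conv_rhs => rw [← hμ.map_eq, Measure.map_map (measurable_comp_left hf) hμ.measurable]
  rfl

variable [Fintype B] [MeasurableSingletonClass B]

theorem map_comp_cyl (hA : mA = mB.comap f) (μ : Measure (ℕ → A)) {n : ℕ} (a : Fin n → A) :
    μ.map (f ∘ ·) (cyl (f ∘ a)) = μ (cyl a) := by
  have hf : Measurable f := measurable_iff_comap_le.2 hA.ge
  have hF := measurable_comp_left hf
  rw [Measure.map_apply hF (measurableSet_cyl _)]
  refine le_antisymm ?_ (measure_mono fun x hx i => congrArg f (hx i))
  have hpi : (MeasurableSpace.pi : MeasurableSpace (ℕ → A)) ≤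
      MeasurableSpace.comap (fun x : ℕ → A => f ∘ x) MeasurableSpace.pi := by
    refine iSup_le fun i => ?_
    rw [hA, MeasurableSpace.comap_comp]
    exact Measurable.comap_le
      ((measurable_pi_apply i).comp (comap_measurable fun x : ℕ → A => f ∘ x))
  obtain ⟨U, -, hU⟩ := hpi _ (measurableSet_toMeasurable μ (cyl a))
  rw [← measure_toMeasurable (cyl a), ← hU]
  refine measure_mono fun x hx => ?_
  let z : ℕ → A := fun i => if h : i < n then a ⟨i, h⟩ else x i
  have hz : z ∈ (fun x : ℕ → A => f ∘ x) ⁻¹' U := by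
    rw [hU]
    exact subset_toMeasurable _ _ fun i => by simp [z]
  have hzx : f ∘ z = f ∘ x := by
    ext i
    by_cases h : i < n
    · simpa [z, h] using (hx ⟨i, h⟩).symm
    · simp [z, h]
  rw [Set.mem_preimage, hzx] at hz
  exact hz

theorem wp_map_comp (hA : mA = mB.comap f) (μ : Measure (ℕ → A)) {n : ℕ} (a : Fin n → A) :
    wp (μ.map (f ∘ ·)) (f ∘ a) = wp μ a := by
  rw [wp, wp, map_comp_cyl hA]

theorem comp_mem_suppSet_map_iff (hA : mA = mB.comap f) {μ : Measure (ℕ → A)} {x : ℕ → A} :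
    f ∘ x ∈ suppSet (μ.map (f ∘ ·)) ↔ x ∈ suppSet μ :=
  forall_congr' fun n => by rw [← map_comp_cyl hA μ (seg x 0 n)]; rfl

theorem CondFE.map_comp (hA : mA = mB.comap f) (hf : f.Surjective) {μ : Measure (ℕ → A)} {γ : ℝ}
    (h : CondFE μ γ) : CondFE (μ.map (f ∘ ·)) γ := by
  refine ⟨h.1, h.2.mono fun n hn b hb => ?_⟩
  obtain ⟨a, rfl⟩ := hf.comp_left b
  rw [map_comp_cyl hA] at hb
  rw [wp_map_comp hA]
  exact hn a hb

theorem CondSE.map_comp (hA : mA = mB.comap f) (hf : f.Surjective) {μ : Measure (ℕ → A)} {γ : ℝ}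
    (h : CondSE μ γ) : CondSE (μ.map (f ∘ ·)) γ := by
  refine ⟨h.1, h.2.mono fun n hn b hb => ?_⟩
  obtain ⟨a, rfl⟩ := hf.comp_left b
  rw [map_comp_cyl hA] at hb
  rw [wp_map_comp hA]
  exact hn a hb

theorem CondID.map_comp (hA : mA = mB.comap f) (hf : f.Surjective) {μ : Measure (ℕ → A)}
    {k : ℕ → ℝ} (h : CondID μ k) : CondID (μ.map (f ∘ ·)) k := by
  refine ⟨h.1, h.2.1, fun n m a' b' => ?_⟩
  obtain ⟨a, rfl⟩ := hf.comp_left a'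
  obtain ⟨b, rfl⟩ := hf.comp_left b'
  rw [← comp_append, map_comp_cyl hA, map_comp_cyl hA, map_comp_cyl hA, wp_map_comp hA,
    wp_map_comp hA, wp_map_comp hA]
  exact h.2.2 n m a b

theorem badSet_subset_map_comp (hA : mA = mB.comap f) (μ : Measure (ℕ → A)) (N : ℕ) (α ε : ℝ)
    (y : ℕ → A) : badSet μ N α ε y ⊆ badSet (μ.map (f ∘ ·)) N α ε (f ∘ y) := by
  intro s hs
  refine ⟨hs.1, fun hgood => hs.2 ?_⟩
  generalize (N : ℝ) ^ (-1 - ε) = θ at hgood ⊢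
  generalize blockEnd N α s = e at hgood ⊢
  generalize blockStart N α s = q at hgood ⊢
  have hlen (p : ℕ) : blkLen (μ.map (f ∘ ·)) θ e (f ∘ y) p = blkLen μ θ e y p := by
    have hseg (ℓ : ℕ) : seg (f ∘ y) p ℓ = f ∘ seg y p ℓ := rfl
    simp only [blkLen, hseg, wp_map_comp hA]
  have hpos (i : ℕ) : blkPos (μ.map (f ∘ ·)) θ e (f ∘ y) q i = blkPos μ θ e y q i := by
    induction i with
    | zero => rfl
    | succ i ih => simp only [blkPos, ih, hlen]
  have hcount : dCount (μ.map (f ∘ ·)) θ e (f ∘ y) q = dCount μ θ e y q := by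
    simp only [dCount, hpos, hlen]
  intro i j hi hj hij heq
  refine hgood i j (hcount ▸ hi) (hcount ▸ hj) ?_ ?_
  · simpa only [hpos, hlen] using hij
  · simp only [hpos, hlen]
    exact fun t ht => congrArg f (heq t ht)

end Quotient

/-- A measurable structure on a finite type is pulled back from the discrete one on its atoms. -/
theorem eq_comap_rangeFactorization_measurableAtom {A : Type*} [Finite A]
    [mA : MeasurableSpace A] :
    mA = (⊤ : MeasurableSpace (Set.range (measurableAtom : A → Set A))).comap
      (Set.rangeFactorization measurableAtom) := by
  refine le_antisymm (fun S hS => ?_) (fun S hS => ?_)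
  · refine ⟨Set.rangeFactorization measurableAtom '' S, trivial, ?_⟩
    refine subset_antisymm ?_ (Set.subset_preimage_image _ _)
    rintro b ⟨a, ha, hab⟩
    have hab' : measurableAtom a = measurableAtom b := congrArg Subtype.val hab
    exact measurableAtom_subset hS ha (hab' ▸ mem_measurableAtom_self b)
  · obtain ⟨T, -, rfl⟩ := hS
    have hT : Set.rangeFactorization measurableAtom ⁻¹' T =
        ⋃ a ∈ Set.rangeFactorization measurableAtom ⁻¹' T, measurableAtom (a : A) := by
      refine subset_antisymm (fun a ha => Set.mem_biUnion ha (mem_measurableAtom_self a)) ?_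
      refine Set.iUnion₂_subset fun a ha b hb => ?_
      have hab : Set.rangeFactorization measurableAtom b =
          Set.rangeFactorization (measurableAtom : A → Set A) a :=
        Subtype.ext (measurableAtom_eq_of_mem hb)
      rwa [Set.mem_preimage, hab]
    rw [hT]
    exact (Set.toFinite _).measurableSet_biUnion fun a _ =>
      MeasurableSet.measurableAtom_of_countable a

/-- **Bound (3.8).** Probability of having at least `ε M_N` bad blocks. -/
theorem many_bad_blocks_prob {A : Type*} [Fintype A] [MeasurableSpace A]
    (μP μQ : Measure (ℕ → A)) [IsProbabilityMeasure μP] [IsProbabilityMeasure μQ]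
    (hPstat : MeasurePreserving shift μP μP)
    (hQstat : MeasurePreserving shift μQ μQ)
    (hsupp : suppSet μQ ⊆ suppSet μP)
    (γp γm : ℝ) (hPFE : CondFE μP γp) (hPSE : CondSE μP γm)
    (kQ : ℕ → ℝ) (hQID : CondID μQ kQ) (hQFE : CondFE μQ γp)
    (ε α : ℝ) (hε : 0 < ε ∧ ε < 1 / 2) (hα : 0 < α ∧ α < γp / (8 * γm)) :
    ∀ᶠ N : ℕ in atTop,
      (μQ {y | ε * blockM N α ≤ ((badSet μP N α ε y).ncard : ℝ)}).toReal ≤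
        Real.exp (-(N : ℝ) ^ (1 - α) *
          (2 * α * ε * Real.log N - 2 * ε * kQ ⌈ellMinus N γm⌉₊ - 2 * Real.log 2)) := by
  let : MeasurableSpace (Set.range (measurableAtom : A → Set A)) := ⊤
  have : MeasurableSingletonClass (Set.range (measurableAtom : A → Set A)) := ⟨fun _ => trivial⟩
  have hA := eq_comap_rangeFactorization_measurableAtom (A := A)
  have hsurj : Function.Surjective (Set.rangeFactorization (measurableAtom : A → Set A)) :=
    Set.rangeFactorization_surjective
  set f := Set.rangeFactorization (measurableAtom : A → Set A)
  have hf : Measurable f := measurable_iff_comap_le.2 hA.ge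
  have hF := measurable_comp_left hf
  have := Measure.isProbabilityMeasure_map (μ := μP) hF.aemeasurable
  have := Measure.isProbabilityMeasure_map (μ := μQ) hF.aemeasurable
  have hsupp' : suppSet (μQ.map (f ∘ ·)) ⊆ suppSet (μP.map (f ∘ ·)) := by
    intro y hy
    obtain ⟨x, rfl⟩ := hsurj.comp_left y
    exact (comp_mem_suppSet_map_iff hA).2 (hsupp ((comp_mem_suppSet_map_iff hA).1 hy))
  filter_upwards [many_bad_blocks_prob_of_measurableSingletonClass _ _
    (measurePreserving_shift_map_comp hf hPstat) (measurePreserving_shift_map_comp hf hQstat)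
    hsupp' (hPSE.map_comp hA hsurj) (hQID.map_comp hA hsurj) (hQFE.map_comp hA hsurj)
    hε.1 hα.1 hα.2] with N hN
  refine le_trans (ENNReal.toReal_mono (measure_ne_top _ _) ?_) hN
  refine le_trans (measure_mono fun y hy => ?_) (Measure.le_map_apply hF.aemeasurable _)
  refine (Set.mem_ofPred.1 hy).trans (Nat.cast_le.2
    (Set.ncard_le_ncard (badSet_subset_map_comp hA μP N α ε y) ?_))
  exact (Set.finite_Iio _).subset fun s hs => hs.1

end ZM
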